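/- Let (A,B) be a Katsura pair. The KEP-action (G_B, E_A) is contracting if and only if limsup_{n→∞} ( max{ |B_μ|/A_μ : μ a path of length n in E_{A,∞} } )^{1/n} < 1, where the maximum over the empty set is taken to be 0. -/

import Mathlib

open scoped Classical

/-- A Katsura pair on a vertex set `V`: matrices `A` (natural entries) and `B` (integer
entries) with `A i j = 0 → B i j = 0`. -/
structure KatsuraPair (V : Type) where
  A : V → V → ℕ
  B : V → V → ℤ
  zero : ∀ i j, A i j = 0 → B i j = 0

namespace KatsuraPair

variable {V : Type}

/-- An edge `e_{i,j,m}` (with `0 ≤ m < A i j`) of the graph `E_A`; the range is `i` and the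
source is `j`. -/
structure Edge (P : KatsuraPair V) where
  i : V
  j : V
  m : ℕ
  hm : m < P.A i j

variable {P : KatsuraPair V}

/-- A finite path `μ = μ₁⋯μₙ`: consecutive edges satisfy `s(μₜ) = r(μₜ₊₁)`. -/
def IsPath (μ : List (Edge P)) : Prop := μ.Chain' (fun e f => e.j = f.i)

/-- `r(μ) = v` (vacuously true for the empty path, viewed as a vertex). -/
def rangeIs (μ : List (Edge P)) (v : V) : Prop := ∀ e ∈ μ.head?, e.i = v

/-- The source of a path whose range is `v` (so `s` of the empty path at `v` is `v`). -/
def src (v : V) (μ : List (Edge P)) : V := (μ.getLast?).elim v (fun e => e.j)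

/-- `A_μ`, the product of the `A`-entries along `μ` (empty product is 1). -/
def Aprod (μ : List (Edge P)) : ℕ := (μ.map (fun e => P.A e.i e.j)).prod

/-- `B_μ`, the product of the `B`-entries along `μ` (empty product is 1). -/
def Bprod (μ : List (Edge P)) : ℤ := (μ.map (fun e => P.B e.i e.j)).prod

/-- `a^k · e_{i,j,m} = e_{i,j,m̂}` where `k·B i j + m = k̂·(A i j) + m̂`, `0 ≤ m̂ < A i j`. -/
def edgeAct (k : ℤ) (e : Edge P) : Edge P where
  i := e.i
  j := e.j
  m := ((k * P.B e.i e.j + (e.m : ℤ)) % (P.A e.i e.j : ℤ)).toNat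
  hm := by
    have hA : 0 < P.A e.i e.j := Nat.lt_of_le_of_lt (Nat.zero_le _) e.hm
    have hA' : (0 : ℤ) < (P.A e.i e.j : ℤ) := by exact_mod_cast hA
    have h1 : 0 ≤ (k * P.B e.i e.j + (e.m : ℤ)) % (P.A e.i e.j : ℤ) :=
      Int.emod_nonneg _ hA'.ne'
    have h2 : (k * P.B e.i e.j + (e.m : ℤ)) % (P.A e.i e.j : ℤ) < (P.A e.i e.j : ℤ) :=
      Int.emod_lt_of_pos _ hA'
    omega

/-- `a^k|_{e_{i,j,m}} = a^{k̂}` where `k·B i j + m = k̂·(A i j) + m̂`, `0 ≤ m̂ < A i j`. -/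
def edgeRes (k : ℤ) (e : Edge P) : ℤ := (k * P.B e.i e.j + (e.m : ℤ)) / (P.A e.i e.j : ℤ)

/-- The action of `a^k` on finite paths: `a^k · (eν) = (a^k · e)(a^k|_e · ν)`. -/
def act : ℤ → List (Edge P) → List (Edge P)
  | _, [] => []
  | k, e :: ν => edgeAct k e :: act (edgeRes k e) ν

/-- The restriction along a path: `a^k|_{eν} = (a^k|_e)|_ν`; `res k μ` is the integer with
`a^k|_μ = a^{res k μ}`. -/
def res : ℤ → List (Edge P) → ℤ
  | k, [] => k
  | k, e :: ν => res (edgeRes k e) ν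

/-- `a^k` and `a^l` act equally at the vertex `v`. -/
def ActEq (P : KatsuraPair V) (k l : ℤ) (v : V) : Prop :=
  ∀ μ : List (Edge P), IsPath μ → rangeIs μ v → act k μ = act l μ

/-- The KEP-action `(G_B, E_A)` is contracting. -/
def Contracting (P : KatsuraPair V) : Prop :=
  ∃ F : Finset ℤ, ∀ k : ℤ, ∀ v : V, ∃ n : ℕ, ∀ μ : List (Edge P),
    IsPath μ → rangeIs μ v → n ≤ μ.length →
    ∃ l ∈ F, ActEq P (res k μ) l (src v μ)

/-- The KEP-action `(G_B, E_A)` is regular. -/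
def Regular (P : KatsuraPair V) : Prop :=
  ∀ k : ℤ, ∀ v : V, ∃ K : ℕ, ∀ μ : List (Edge P),
    IsPath μ → rangeIs μ v → K ≤ μ.length → act k μ = μ →
    ActEq P (res k μ) 0 (src v μ)

/-- `v ∈ E⁰_{A,<∞}`: the quantity `A_μ / gcd(A_μ, |B_μ|)` is bounded over paths `μ` with
range `v` and `B_μ ≠ 0`. -/
def FiniteVertex (P : KatsuraPair V) (v : V) : Prop :=
  ∃ C : ℕ, ∀ μ : List (Edge P), IsPath μ → rangeIs μ v → Bprod μ ≠ 0 →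
    Aprod μ / Nat.gcd (Aprod μ) (Bprod μ).natAbs ≤ C

/-- An edge of `E_{A,∞}`: `B` nonzero and source in `E⁰_{A,∞}`. -/
def InfEdge (e : Edge P) : Prop := P.B e.i e.j ≠ 0 ∧ ¬ FiniteVertex P e.j

/-- An edge of `E_{A,<∞}`: `B` nonzero and range in `E⁰_{A,<∞}`. -/
def FinEdge (e : Edge P) : Prop := P.B e.i e.j ≠ 0 ∧ FiniteVertex P e.i

/-- The infinite part `(A_∞, B_∞)` of a Katsura pair. -/
def infinitePart (P : KatsuraPair V) : KatsuraPair {v : V // ¬ FiniteVertex P v} where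
  A := fun i j => if P.B i.1 j.1 = 0 then 0 else P.A i.1 j.1
  B := fun i j => P.B i.1 j.1
  zero := fun i j h => by
    by_cases hb : P.B i.1 j.1 = 0
    · exact hb
    · simp only [if_neg hb] at h
      exact P.zero _ _ h

/-- The finite part `(A_{<∞}, B_{<∞})` of a Katsura pair. -/
def finitePart (P : KatsuraPair V) : KatsuraPair {v : V // FiniteVertex P v} where
  A := fun i j => if P.B i.1 j.1 = 0 then 0 else P.A i.1 j.1
  B := fun i j => P.B i.1 j.1
  zero := fun i j h => by
    by_cases hb : P.B i.1 j.1 = 0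
    · exact hb
    · simp only [if_neg hb] at h
      exact P.zero _ _ h

end KatsuraPair

namespace KatsuraPair

variable {V : Type}

/-- `max { |B_μ|/A_μ : μ a path of length n in E_{A,∞} }` (max over the empty set is 0). -/
noncomputable def maxRatioInf (P : KatsuraPair V) (n : ℕ) : ℝ :=
  sSup (insert 0 {x : ℝ | ∃ μ : List (Edge P), IsPath μ ∧ (∀ e ∈ μ, InfEdge e) ∧
    μ.length = n ∧ x = ((Bprod μ).natAbs : ℝ) / (Aprod μ : ℝ)})

end KatsuraPair

open scoped Topology

namespace KatsuraPair

variable {V : Type} {P : KatsuraPair V}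

theorem Edge.A_pos (e : Edge P) : 0 < P.A e.i e.j := (Nat.zero_le _).trans_lt e.hm

theorem isPath_cons {e : Edge P} {ν : List (Edge P)} :
    IsPath (e :: ν) ↔ rangeIs ν e.j ∧ IsPath ν := by
  simp only [rangeIs, eq_comm (b := e.j)]
  exact List.isChain_cons

theorem rangeIs_cons {e : Edge P} {ν : List (Edge P)} {v : V} :
    rangeIs (e :: ν) v ↔ e.i = v := by
  simp [rangeIs]

theorem src_cons (v : V) (e : Edge P) (ν : List (Edge P)) :
    src v (e :: ν) = src e.j ν := by
  cases ν with
  | nil => rfl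
  | cons f ν => simp [src, List.getLast?_cons]

theorem Aprod_cons (e : Edge P) (ν : List (Edge P)) :
    Aprod (e :: ν) = P.A e.i e.j * Aprod ν := by
  simp [Aprod]

theorem Bprod_cons (e : Edge P) (ν : List (Edge P)) :
    Bprod (e :: ν) = P.B e.i e.j * Bprod ν := by
  simp [Bprod]

theorem Aprod_pos (μ : List (Edge P)) : 0 < Aprod μ := by
  induction μ with
  | nil => simp [Aprod]
  | cons e ν ih => rw [Aprod_cons]; exact Nat.mul_pos e.A_pos ih

theorem src_not_finiteVertex {μ : List (Edge P)} (hne : μ ≠ []) (h : ∀ e ∈ μ, InfEdge e) (v : V) :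
    ¬ FiniteVertex P (src v μ) := by
  simpa [src, List.getLast?_eq_some_getLast hne] using (h _ (List.getLast_mem hne)).2

/-- The ratio `|B_μ| / A_μ`. -/
noncomputable def ratio (μ : List (Edge P)) : ℝ := ((Bprod μ).natAbs : ℝ) / (Aprod μ : ℝ)

theorem ratio_nil : ratio ([] : List (Edge P)) = 1 := by
  simp [ratio, Aprod, Bprod]

theorem ratio_cons (e : Edge P) (ν : List (Edge P)) :
    ratio (e :: ν) = |(P.B e.i e.j : ℝ)| / (P.A e.i e.j : ℝ) * ratio ν := by
  simp only [ratio, Aprod_cons, Bprod_cons, Int.natAbs_mul, Nat.cast_mul, Nat.cast_natAbs,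
    Int.cast_abs]
  rw [mul_div_mul_comm]

theorem ratio_append (μ ν : List (Edge P)) : ratio (μ ++ ν) = ratio μ * ratio ν := by
  induction μ with
  | nil => simp [ratio_nil]
  | cons e μ ih => rw [List.cons_append, ratio_cons, ih, ratio_cons, mul_assoc]

theorem ratio_nonneg (μ : List (Edge P)) : 0 ≤ ratio μ := by
  unfold ratio; positivity

theorem exists_ratio_le_pow [Fintype V] (P : KatsuraPair V) :
    ∃ c : ℝ, 1 ≤ c ∧ ∀ μ : List (Edge P), ratio μ ≤ c ^ μ.length := by
  have hsum : 0 ≤ ∑ p : V × V, |(P.B p.1 p.2 : ℝ)| := Finset.sum_nonneg fun _ _ => abs_nonneg _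
  refine ⟨1 + ∑ p : V × V, |(P.B p.1 p.2 : ℝ)|, by linarith, fun μ => ?_⟩
  induction μ with
  | nil => simp [ratio_nil]
  | cons e ν ih =>
    rw [ratio_cons, List.length_cons, pow_succ']
    refine mul_le_mul ?_ ih (ratio_nonneg _) (by linarith)
    have h1 : (1 : ℝ) ≤ P.A e.i e.j := by exact_mod_cast e.A_pos
    have h2 : |(P.B e.i e.j : ℝ)| ≤ ∑ p : V × V, |(P.B p.1 p.2 : ℝ)| :=
      Finset.single_le_sum (f := fun p : V × V => |(P.B p.1 p.2 : ℝ)|)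
        (fun _ _ => abs_nonneg _) (Finset.mem_univ (e.i, e.j))
    linarith [div_le_self (abs_nonneg (P.B e.i e.j : ℝ)) h1]

theorem div_gcd_dvd_iff {a b t : ℕ} (ha : 0 < a) : a / a.gcd b ∣ t ↔ a ∣ t * b := by
  have hg : 0 < a.gcd b := Nat.gcd_pos_of_pos_left _ ha
  have hco : (a / a.gcd b).Coprime (b / a.gcd b) := Nat.coprime_div_gcd_div_gcd hg
  rw [← hco.dvd_mul_right, ← Nat.mul_dvd_mul_iff_right hg, mul_assoc,
    Nat.div_mul_cancel (Nat.gcd_dvd_left _ _), Nat.div_mul_cancel (Nat.gcd_dvd_right _ _)]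

theorem FiniteVertex.source {e : Edge P} (hB : P.B e.i e.j ≠ 0) (h : FiniteVertex P e.i) :
    FiniteVertex P e.j := by
  obtain ⟨C, hC⟩ := h
  refine ⟨C * (P.B e.i e.j).natAbs, fun ν hν hr hne => ?_⟩
  have hBe : Bprod (e :: ν) ≠ 0 := by rw [Bprod_cons]; exact mul_ne_zero hB hne
  have hle := hC (e :: ν) (isPath_cons.2 ⟨hr, hν⟩) (rangeIs_cons.2 rfl) hBe
  have hdvd := (div_gcd_dvd_iff (b := (Bprod (e :: ν)).natAbs) (Aprod_pos (e :: ν))).1 dvd_rfl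
  set T := Aprod (e :: ν) / (Aprod (e :: ν)).gcd (Bprod (e :: ν)).natAbs
  have hT : 0 < T := Nat.div_pos (Nat.gcd_le_left _ (Aprod_pos _))
    (Nat.gcd_pos_of_pos_left _ (Aprod_pos _))
  rw [Aprod_cons, Bprod_cons, Int.natAbs_mul, ← mul_assoc] at hdvd
  have := (div_gcd_dvd_iff (Aprod_pos ν)).2 ((Dvd.intro_left _ rfl).trans hdvd)
  exact (Nat.le_of_dvd (Nat.mul_pos hT (Int.natAbs_pos.2 hB)) this).trans
    (Nat.mul_le_mul_right _ hle)

theorem infEdge_of_src {μ : List (Edge P)} {v : V} (hμ : IsPath μ) (hr : rangeIs μ v)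
    (hB : Bprod μ ≠ 0) (hs : ¬ FiniteVertex P (src v μ)) :
    ¬ FiniteVertex P v ∧ ∀ e ∈ μ, InfEdge e := by
  induction μ generalizing v with
  | nil => simpa [src] using hs
  | cons e ν ih =>
    rw [isPath_cons] at hμ
    rw [Bprod_cons] at hB
    rw [src_cons] at hs
    obtain ⟨h1, h2⟩ := ih hμ.2 hμ.1 (right_ne_zero_of_mul hB) hs
    have hBe := left_ne_zero_of_mul hB
    refine ⟨fun hv => h1 (FiniteVertex.source hBe ((rangeIs_cons.1 hr).symm ▸ hv)), ?_⟩
    simpa using ⟨⟨hBe, h1⟩, h2⟩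

theorem edgeAct_eq_iff {k l : ℤ} {e : Edge P} :
    edgeAct k e = edgeAct l e ↔ (P.A e.i e.j : ℤ) ∣ (k - l) * P.B e.i e.j := by
  have hA : (0 : ℤ) < P.A e.i e.j := by exact_mod_cast e.A_pos
  have h1 := Int.emod_nonneg (k * P.B e.i e.j + e.m) hA.ne'
  have h2 := Int.emod_nonneg (l * P.B e.i e.j + e.m) hA.ne'
  have h3 : edgeAct k e = edgeAct l e ↔
      (k * P.B e.i e.j + e.m) % P.A e.i e.j = (l * P.B e.i e.j + e.m) % P.A e.i e.j := by
    simp only [edgeAct, Edge.mk.injEq, true_and]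
    omega
  rw [h3, Int.emod_eq_emod_iff_emod_sub_eq_zero, ← Int.dvd_iff_emod_eq_zero,
    add_sub_add_right_eq_sub, ← sub_mul]

theorem edgeRes_sub_mul {k l : ℤ} {e : Edge P} (h : edgeAct k e = edgeAct l e) :
    (edgeRes k e - edgeRes l e) * P.A e.i e.j = (k - l) * P.B e.i e.j := by
  have hA : (0 : ℤ) < P.A e.i e.j := by exact_mod_cast e.A_pos
  have h1 := Int.emod_nonneg (k * P.B e.i e.j + e.m) hA.ne'
  have h2 := Int.emod_nonneg (l * P.B e.i e.j + e.m) hA.ne'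
  have h3 : ((k * P.B e.i e.j + e.m) % P.A e.i e.j) = (l * P.B e.i e.j + e.m) % P.A e.i e.j := by
    have := congrArg Edge.m h
    simp only [edgeAct] at this
    omega
  have h4 := Int.mul_ediv_add_emod (k * P.B e.i e.j + e.m) (P.A e.i e.j)
  have h5 := Int.mul_ediv_add_emod (l * P.B e.i e.j + e.m) (P.A e.i e.j)
  simp only [edgeRes]
  linear_combination h4 - h5 - h3

theorem res_sub_mul {k l : ℤ} {μ : List (Edge P)} (h : act k μ = act l μ) :
    (res k μ - res l μ) * Aprod μ = (k - l) * Bprod μ := by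
  induction μ generalizing k l with
  | nil => simp [res, Aprod, Bprod]
  | cons e ν ih =>
    simp only [act, List.cons.injEq] at h
    rw [Aprod_cons, Bprod_cons, res, res]
    push_cast
    linear_combination (P.A e.i e.j : ℤ) * ih h.2 + Bprod ν * edgeRes_sub_mul h.1

theorem ActEq.eq_of_not_finiteVertex {k l : ℤ} {v : V} (h : ActEq P k l v)
    (hv : ¬ FiniteVertex P v) : k = l := by
  by_contra hkl
  refine hv ⟨(k - l).natAbs, fun μ hμ hr _ => Nat.le_of_dvd (Int.natAbs_pos.2 (sub_ne_zero.2 hkl)) ?_⟩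
  rw [div_gcd_dvd_iff (Aprod_pos μ), ← Int.natAbs_mul, ← Int.natCast_dvd]
  exact Dvd.intro_left _ (res_sub_mul (h μ hμ hr))

theorem act_eq_of_dvd {k l : ℤ} {μ : List (Edge P)}
    (h : ∀ ν, ν <+: μ → (Aprod ν : ℤ) ∣ (k - l) * Bprod ν) : act k μ = act l μ := by
  induction μ generalizing k l with
  | nil => rfl
  | cons e ν ih =>
    have he : edgeAct k e = edgeAct l e := by
      rw [edgeAct_eq_iff]
      simpa [Aprod, Bprod] using h [e] (by simp)
    rw [act, act, he, ih]
    intro ν' hν'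
    have h1 := h (e :: ν') ((List.prefix_cons_inj e).2 hν')
    have hA : (P.A e.i e.j : ℤ) ≠ 0 := by exact_mod_cast e.A_pos.ne'
    refine Int.dvd_of_mul_dvd_mul_left hA ?_
    rw [Aprod_cons, Bprod_cons, ← mul_assoc, ← edgeRes_sub_mul he] at h1
    push_cast at h1
    convert h1 using 1
    ring

theorem FiniteVertex.exists_actEq {v : V} (hv : FiniteVertex P v) :
    ∃ L : ℕ, 0 < L ∧ ∀ k : ℤ, ActEq P k (k % L) v := by
  obtain ⟨C, hC⟩ := hv
  refine ⟨C.factorial, C.factorial_pos, fun k μ hμ hr => act_eq_of_dvd fun ν hν => ?_⟩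
  by_cases hB : Bprod ν = 0
  · simp [hB]
  have hrν : rangeIs ν v := by
    intro e he
    obtain ⟨t, rfl⟩ := hν
    exact hr e (by simp [List.head?_append, Option.mem_def.1 he])
  have hle := hC ν (hμ.prefix hν) hrν hB
  have hpos : 0 < Aprod ν / (Aprod ν).gcd (Bprod ν).natAbs :=
    Nat.div_pos (Nat.gcd_le_left _ (Aprod_pos _)) (Nat.gcd_pos_of_pos_left _ (Aprod_pos _))
  have h1 := (div_gcd_dvd_iff (Aprod_pos ν)).1 (Nat.dvd_factorial hpos hle)
  have h2 : (Aprod ν : ℤ) ∣ C.factorial * Bprod ν := by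
    rw [Int.natCast_dvd, Int.natAbs_mul]; simpa using h1
  exact h2.trans (mul_dvd_mul_right (Int.dvd_self_sub_emod) _)

theorem abs_edgeRes_le (k : ℤ) (e : Edge P) :
    |(edgeRes k e : ℝ)| ≤ |(k : ℝ)| * (|(P.B e.i e.j : ℝ)| / P.A e.i e.j) + 1 := by
  have hA : (0 : ℝ) < P.A e.i e.j := by exact_mod_cast e.A_pos
  have hm : (e.m : ℝ) < P.A e.i e.j := by exact_mod_cast e.hm
  have hm0 : (0 : ℝ) ≤ e.m := by positivity
  have hfl : edgeRes k e = ⌊((k * P.B e.i e.j + e.m : ℤ) : ℝ) / (P.A e.i e.j : ℝ)⌋ := by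
    rw [Int.floor_div_natCast, Int.floor_intCast]; rfl
  rw [← mul_div_assoc, ← abs_mul]
  set x : ℝ := k * P.B e.i e.j with hx
  have h1 := Int.floor_le (((k * P.B e.i e.j + e.m : ℤ) : ℝ) / (P.A e.i e.j : ℝ))
  have h2 := Int.lt_floor_add_one (((k * P.B e.i e.j + e.m : ℤ) : ℝ) / (P.A e.i e.j : ℝ))
  rw [← hfl] at h1 h2
  push_cast at h1 h2
  rw [← hx, add_div] at h1 h2
  have h3 : (e.m : ℝ) / P.A e.i e.j < 1 := (div_lt_one hA).2 hm
  have h4 : 0 ≤ (e.m : ℝ) / P.A e.i e.j := by positivity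
  have h5 : |x| / (P.A e.i e.j : ℝ) = |x / P.A e.i e.j| := by rw [abs_div, abs_of_pos hA]
  rw [h5, abs_le]
  constructor <;> linarith [neg_abs_le (x / P.A e.i e.j), le_abs_self (x / P.A e.i e.j)]

theorem abs_res_le {C r : ℝ} (hr0 : 0 ≤ r) (hr1 : r < 1) (hC : 0 ≤ C)
    (h : ∀ μ : List (Edge P), IsPath μ → (∀ e ∈ μ, InfEdge e) → ratio μ ≤ C * r ^ μ.length)
    (k : ℤ) {μ : List (Edge P)} {v : V} (hμ : IsPath μ) (hr : rangeIs μ v)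
    (hs : ¬ FiniteVertex P (src v μ)) :
    |(res k μ : ℝ)| ≤ |(k : ℝ)| * ratio μ + C / (1 - r) * (1 - r ^ μ.length) := by
  induction μ generalizing v k with
  | nil => simp [res, ratio_nil]
  | cons e ν ih =>
    rw [isPath_cons] at hμ
    rw [src_cons] at hs
    have hν : ratio ν ≤ C * r ^ ν.length := by
      by_cases hB : Bprod ν = 0
      · simp only [ratio, hB]; simp; positivity
      · exact h ν hμ.2 (infEdge_of_src hμ.2 hμ.1 hB hs).2
    have h1 := ih (edgeRes k e) hμ.2 hμ.1 hs
    have h2 := mul_le_mul_of_nonneg_right (abs_edgeRes_le k e) (ratio_nonneg ν)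
    have h3 : C / (1 - r) * (1 - r ^ (ν.length + 1)) =
        C / (1 - r) * (1 - r ^ ν.length) + C * r ^ ν.length := by
      have : 1 - r ≠ 0 := by linarith
      field_simp
      ring
    rw [res, ratio_cons, List.length_cons, h3]
    linarith

theorem contracting_of_ratio_le [Fintype V] {C r : ℝ} (hr0 : 0 ≤ r) (hr1 : r < 1) (hC : 0 ≤ C)
    (h : ∀ μ : List (Edge P), IsPath μ → (∀ e ∈ μ, InfEdge e) → ratio μ ≤ C * r ^ μ.length) :
    Contracting P := by
  have hL : ∀ v : V, ∃ L : ℕ, 0 < L ∧ (FiniteVertex P v → ∀ k : ℤ, ActEq P k (k % L) v) := by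
    intro v
    by_cases hv : FiniteVertex P v
    · obtain ⟨L, hL, h⟩ := hv.exists_actEq
      exact ⟨L, hL, fun _ => h⟩
    · exact ⟨1, one_pos, fun h => absurd h hv⟩
  choose L hL0 hL using hL
  obtain ⟨K, hK⟩ := exists_nat_ge (1 + C / (1 - r))
  set R : ℤ := K + ∑ v, (L v : ℤ) with hR
  have hLR : ∀ v, (L v : ℤ) ≤ ∑ v, (L v : ℤ) := fun v =>
    Finset.single_le_sum (f := fun v => (L v : ℤ)) (fun _ _ => by positivity) (Finset.mem_univ v)
  have hsum : 0 ≤ ∑ v, (L v : ℤ) := Finset.sum_nonneg fun _ _ => by positivity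
  refine ⟨Finset.Icc (-R) R, fun k v => ?_⟩
  have hlim : Filter.Tendsto (fun n : ℕ => |(k : ℝ)| * (C * r ^ n)) Filter.atTop (𝓝 0) := by
    simpa using ((tendsto_pow_atTop_nhds_zero_of_lt_one hr0 hr1).const_mul C).const_mul |(k : ℝ)|
  obtain ⟨n, hn⟩ := Filter.eventually_atTop.1 (hlim.eventually_le_const zero_lt_one)
  refine ⟨n, fun μ hμ hrμ hlen => ?_⟩
  by_cases hs : FiniteVertex P (src v μ)
  · refine ⟨_, ?_, hL _ hs _⟩
    have hpos : (0 : ℤ) < L (src v μ) := by exact_mod_cast hL0 _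
    have h1 := Int.emod_nonneg (res k μ) hpos.ne'
    have h2 := Int.emod_lt_of_pos (res k μ) hpos
    have h3 := hLR (src v μ)
    rw [Finset.mem_Icc]
    omega
  · refine ⟨res k μ, ?_, fun _ _ _ => rfl⟩
    have h1 := abs_res_le hr0 hr1 hC h k hμ hrμ hs
    have h2 : ratio μ ≤ C * r ^ μ.length := by
      by_cases hB : Bprod μ = 0
      · simp only [ratio, hB]; simp; positivity
      · exact h μ hμ (infEdge_of_src hμ hrμ hB hs).2
    have h3 := mul_le_mul_of_nonneg_left h2 (abs_nonneg (k : ℝ))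
    have h4 := hn _ hlen
    have h5 : C / (1 - r) * (1 - r ^ μ.length) ≤ C / (1 - r) :=
      mul_le_of_le_one_right (div_nonneg hC (by linarith)) (by linarith [pow_nonneg hr0 μ.length])
    have h6 : |res k μ| ≤ (K : ℤ) := by
      have : |(res k μ : ℝ)| ≤ K := by linarith
      exact_mod_cast this
    rw [Finset.mem_Icc, ← abs_le]
    omega

theorem exists_edge_le_abs_edgeRes (k : ℤ) (e : Edge P) :
    ∃ f : Edge P, f.i = e.i ∧ f.j = e.j ∧
      |(k : ℝ)| * (|(P.B e.i e.j : ℝ)| / P.A e.i e.j) ≤ |(edgeRes k f : ℝ)| := by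
  have hA : (0 : ℝ) < P.A e.i e.j := by exact_mod_cast e.A_pos
  have hAZ : (0 : ℤ) < P.A e.i e.j := by exact_mod_cast e.A_pos
  have key : ∀ q : ℤ, |k * P.B e.i e.j| ≤ |q| * P.A e.i e.j →
      |(k : ℝ)| * (|(P.B e.i e.j : ℝ)| / P.A e.i e.j) ≤ |(q : ℝ)| := by
    intro q hq
    rw [← mul_div_assoc, div_le_iff₀ hA, ← abs_mul]
    exact_mod_cast hq
  rcases le_total 0 (k * P.B e.i e.j) with hk | hk
  · refine ⟨⟨e.i, e.j, P.A e.i e.j - 1, Nat.sub_lt e.A_pos one_pos⟩, rfl, rfl, key _ ?_⟩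
    have h1 : ((P.A e.i e.j - 1 : ℕ) : ℤ) = P.A e.i e.j - 1 := by
      rw [Nat.cast_sub e.A_pos]; simp
    simp only [edgeRes, h1]
    have h2 := Int.lt_ediv_add_one_mul_self (k * P.B e.i e.j + (P.A e.i e.j - 1)) hAZ
    rw [abs_of_nonneg hk]
    nlinarith [le_abs_self ((k * P.B e.i e.j + ((P.A e.i e.j : ℤ) - 1)) / (P.A e.i e.j : ℤ))]
  · refine ⟨⟨e.i, e.j, 0, e.A_pos⟩, rfl, rfl, key _ ?_⟩
    simp only [edgeRes, Nat.cast_zero, add_zero]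
    have h2 := Int.ediv_mul_le (k * P.B e.i e.j) hAZ.ne'
    rw [abs_of_nonpos hk]
    nlinarith [neg_abs_le ((k * P.B e.i e.j) / (P.A e.i e.j : ℤ))]

theorem exists_path_le_abs_res (k : ℤ) (μ : List (Edge P)) :
    ∃ ν : List (Edge P), ν.length = μ.length ∧ (IsPath μ → IsPath ν) ∧
      (∀ v, rangeIs μ v → rangeIs ν v) ∧ (∀ v, src v ν = src v μ) ∧
      |(k : ℝ)| * ratio μ ≤ |(res k ν : ℝ)| := by
  induction μ generalizing k with
  | nil => exact ⟨[], rfl, id, fun _ => id, fun _ => rfl, by simp [res, ratio_nil]⟩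
  | cons e μ ih =>
    obtain ⟨f, hi, hj, hf⟩ := exists_edge_le_abs_edgeRes k e
    obtain ⟨ν, hlen, hp, hr, hs, hν⟩ := ih (edgeRes k f)
    refine ⟨f :: ν, by simp [hlen], ?_, ?_, ?_, ?_⟩
    · simp only [isPath_cons, hj]
      exact fun h => ⟨hr _ h.1, hp h.2⟩
    · simp [rangeIs_cons, hi]
    · simp [src_cons, hs, hj]
    · rw [res, ratio_cons, ← mul_assoc]
      exact (mul_le_mul_of_nonneg_right hf (ratio_nonneg μ)).trans hν

theorem Contracting.exists_ratio_le_half [Fintype V] (h : Contracting P) :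
    ∃ n : ℕ, 0 < n ∧ ∀ μ : List (Edge P), IsPath μ → (∀ e ∈ μ, InfEdge e) → μ.length = n →
      ratio μ ≤ 1 / 2 := by
  obtain ⟨F, hF⟩ := h
  set K : ℤ := ∑ l ∈ F, |l| with hK
  have hKF : ∀ l ∈ F, |l| ≤ K := fun l hl =>
    Finset.single_le_sum (f := fun l : ℤ => |l|) (fun _ _ => abs_nonneg _) hl
  have hK0 : 0 ≤ K := Finset.sum_nonneg fun _ _ => abs_nonneg _
  choose n hn using hF (2 * K + 1)
  refine ⟨1 + ∑ v, n v, by omega, fun μ hμ hinf hlen => ?_⟩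
  obtain ⟨e, μ', rfl⟩ := List.exists_cons_of_length_pos (l := μ) (by omega)
  obtain ⟨ν, hνlen, hp, hr, hs, hν⟩ := exists_path_le_abs_res (2 * K + 1) (e :: μ')
  have hle : n e.i ≤ ∑ v, n v :=
    Finset.single_le_sum (f := n) (fun _ _ => Nat.zero_le _) (Finset.mem_univ _)
  obtain ⟨l, hl, hact⟩ := hn e.i ν (hp hμ) (hr _ (rangeIs_cons.2 rfl)) (by omega)
  rw [hact.eq_of_not_finiteVertex
    (by rw [hs]; exact src_not_finiteVertex (List.cons_ne_nil _ _) hinf _)] at hν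
  have h1 : |(l : ℝ)| ≤ K := by exact_mod_cast hKF l hl
  have h2 : (0 : ℝ) ≤ K := by exact_mod_cast hK0
  push_cast at hν
  rw [abs_of_nonneg (by linarith)] at hν
  nlinarith

theorem ratio_le_of_ratio_le_half {c : ℝ} (hc1 : 1 ≤ c)
    (hc : ∀ μ : List (Edge P), ratio μ ≤ c ^ μ.length) {n : ℕ} (hn0 : 0 < n)
    (hn : ∀ μ : List (Edge P), IsPath μ → (∀ e ∈ μ, InfEdge e) → μ.length = n → ratio μ ≤ 1 / 2)
    {s : ℝ} (hs0 : 0 ≤ s) (hs1 : s ≤ 1) (hs : s ^ n = 1 / 2) (μ : List (Edge P)) (hμ : IsPath μ)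
    (hinf : ∀ e ∈ μ, InfEdge e) : ratio μ ≤ 2 * c ^ n * s ^ μ.length := by
  induction hl : μ.length using Nat.strong_induction_on generalizing μ with
  | _ m ih =>
    subst hl
    rcases lt_or_ge μ.length n with h | h
    · have h1 := (hc μ).trans (pow_le_pow_right₀ hc1 h.le)
      have h2 : 1 / 2 ≤ s ^ μ.length := hs ▸ pow_le_pow_of_le_one hs0 hs1 h.le
      nlinarith [pow_pos (one_pos.trans_le hc1) n]
    · have h1 := hn (μ.take n) (hμ.prefix (List.take_prefix n μ))
        (fun e he => hinf e (List.mem_of_mem_take he)) (by simpa using h)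
      have h2 := ih (μ.drop n).length (by rw [List.length_drop]; omega) (μ.drop n)
        (hμ.suffix (List.drop_suffix n μ)) (fun e he => hinf e (List.mem_of_mem_drop he)) rfl
      have h3 : s ^ μ.length = 1 / 2 * s ^ (μ.drop n).length := by
        rw [← hs, ← pow_add, List.length_drop]
        congr 1
        omega
      rw [← List.take_append_drop n μ, ratio_append, List.take_append_drop, h3]
      calc _ ≤ 1 / 2 * (2 * c ^ n * s ^ (μ.drop n).length) :=
            mul_le_mul h1 h2 (ratio_nonneg _) (by norm_num)
        _ = _ := by ring

theorem maxRatioInf_le {n : ℕ} {b : ℝ} (hb : 0 ≤ b)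
    (h : ∀ μ : List (Edge P), IsPath μ → (∀ e ∈ μ, InfEdge e) → μ.length = n → ratio μ ≤ b) :
    maxRatioInf P n ≤ b := by
  refine csSup_le (Set.insert_nonempty _ _) ?_
  rintro x (rfl | ⟨μ, hμ, hinf, hl, rfl⟩)
  · exact hb
  · exact h μ hμ hinf hl

theorem bddAbove_ratio {c : ℝ} (hc1 : 1 ≤ c) (hc : ∀ μ : List (Edge P), ratio μ ≤ c ^ μ.length)
    (n : ℕ) : BddAbove (insert 0 {x : ℝ | ∃ μ : List (Edge P), IsPath μ ∧ (∀ e ∈ μ, InfEdge e) ∧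
      μ.length = n ∧ x = ((Bprod μ).natAbs : ℝ) / (Aprod μ : ℝ)}) := by
  refine ⟨c ^ n, ?_⟩
  rintro x (rfl | ⟨μ, hμ, hinf, rfl, rfl⟩)
  · positivity
  · exact hc μ

theorem maxRatioInf_nonneg [Fintype V] (P : KatsuraPair V) (n : ℕ) : 0 ≤ maxRatioInf P n := by
  obtain ⟨c, hc1, hc⟩ := exists_ratio_le_pow P
  exact le_csSup (bddAbove_ratio hc1 hc n) (Set.mem_insert _ _)

theorem ratio_le_maxRatioInf [Fintype V] {μ : List (Edge P)} (hμ : IsPath μ)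
    (hinf : ∀ e ∈ μ, InfEdge e) : ratio μ ≤ maxRatioInf P μ.length := by
  obtain ⟨c, hc1, hc⟩ := exists_ratio_le_pow P
  exact le_csSup (bddAbove_ratio hc1 hc _) (Set.mem_insert_of_mem _ ⟨μ, hμ, hinf, rfl, rfl⟩)

theorem rpow_inv_le_of_le_pow {x y : ℝ} (hx : 0 ≤ x) (hy : 0 ≤ y) {n : ℕ} (hn : n ≠ 0)
    (h : x ≤ y ^ n) : x ^ ((n : ℝ)⁻¹) ≤ y :=
  (Real.rpow_le_rpow hx h (by positivity)).trans_eq (Real.pow_rpow_inv_natCast hy hn)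

theorem contracting_iff_limsup_lt_one [Fintype V] (P : KatsuraPair V) :
    Contracting P ↔
      Filter.limsup (fun n : ℕ => (maxRatioInf P n) ^ ((n : ℝ)⁻¹)) Filter.atTop < 1 := by
  obtain ⟨c, hc1, hc⟩ := exists_ratio_le_pow P
  have hc0 : 0 < c := one_pos.trans_le hc1
  constructor
  · intro h
    obtain ⟨n, hn0, hn⟩ := h.exists_ratio_le_half
    set s : ℝ := (1 / 2 : ℝ) ^ ((n : ℝ)⁻¹) with hs
    have hs0 : 0 ≤ s := by positivity
    have hs1 : s < 1 := Real.rpow_lt_one (by norm_num) (by norm_num) (by positivity)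
    have hsn : s ^ n = 1 / 2 := Real.rpow_inv_natCast_pow (by norm_num) hn0.ne'
    set D : ℝ := 2 * c ^ n with hD
    have hD0 : 0 < D := by positivity
    have hlim : Filter.Tendsto (fun m : ℕ => D ^ ((m : ℝ)⁻¹) * s) Filter.atTop (𝓝 s) := by
      have h1 := (Real.continuousAt_const_rpow (b := (0 : ℝ)) hD0.ne').tendsto.comp
        (tendsto_inv_atTop_nhds_zero_nat (𝕜 := ℝ))
      simpa using h1.mul_const s
    refine (Filter.limsup_le_of_le ?_ ?_ : _ ≤ (1 + s) / 2).trans_lt (by linarith)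
    · exact Filter.isCoboundedUnder_le_of_le _ (x := 0)
        fun m => Real.rpow_nonneg (maxRatioInf_nonneg P m) _
    · filter_upwards [hlim.eventually_le_const (by linarith : s < (1 + s) / 2),
        Filter.eventually_ne_atTop 0] with m hm hm0
      refine le_trans ?_ hm
      have h1 : maxRatioInf P m ≤ D * s ^ m := maxRatioInf_le (by positivity)
        fun μ hμ hinf hl => hl ▸ ratio_le_of_ratio_le_half hc1 hc hn0 hn hs0 hs1.le hsn μ hμ hinf
      refine rpow_inv_le_of_le_pow (maxRatioInf_nonneg P m) (by positivity) hm0 ?_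
      rwa [mul_pow, Real.rpow_inv_natCast_pow hD0.le hm0]
  · intro h
    obtain ⟨r, hr, hr1⟩ := exists_between h
    have hbdd : Filter.IsBoundedUnder (· ≤ ·) Filter.atTop
        (fun n : ℕ => (maxRatioInf P n) ^ ((n : ℝ)⁻¹)) := by
      refine Filter.isBoundedUnder_of_eventually_le (a := c) ?_
      filter_upwards [Filter.eventually_ne_atTop 0] with m hm0
      exact rpow_inv_le_of_le_pow (maxRatioInf_nonneg P m) hc0.le hm0
        (maxRatioInf_le (by positivity) fun μ _ _ hl => hl ▸ hc μ)
    obtain ⟨M, hM⟩ := Filter.eventually_atTop.1 (Filter.eventually_lt_of_limsup_lt hr hbdd)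
    have hr0 : 0 < r := (Real.rpow_nonneg (maxRatioInf_nonneg P M) _).trans_lt (hM M le_rfl)
    refine contracting_of_ratio_le (C := c ^ (M + 1) / r ^ (M + 1)) hr0.le hr1 (by positivity)
      fun μ hμ hinf => ?_
    rw [div_mul_eq_mul_div, le_div_iff₀ (by positivity)]
    rcases le_or_gt μ.length M with hl | hl
    · have h1 := (hc μ).trans (pow_le_pow_right₀ hc1 (hl.trans M.le_succ))
      exact mul_le_mul h1 (pow_le_pow_of_le_one hr0.le hr1.le (hl.trans M.le_succ))
        (by positivity) (by positivity)
    · have h1 : ratio μ ≤ r ^ μ.length := by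
        refine (ratio_le_maxRatioInf hμ hinf).trans ?_
        have h2 := pow_le_pow_left₀ (Real.rpow_nonneg (maxRatioInf_nonneg P _) _)
          (hM _ hl.le).le μ.length
        rwa [Real.rpow_inv_natCast_pow (maxRatioInf_nonneg P _) (by omega)] at h2
      have h2 : r ^ (M + 1) ≤ c ^ (M + 1) := pow_le_pow_left₀ hr0.le (hr1.le.trans hc1) _
      rw [mul_comm (c ^ (M + 1))]
      exact mul_le_mul h1 h2 (by positivity) (by positivity)

end KatsuraPair

open KatsuraPair Filter in
/-- the KEP-action `(G_B, E_A)` is contracting iff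
`limsup_n (max_{μ ∈ E_{A,∞}^n} |B_μ|/A_μ)^{1/n} < 1`. -/
theorem statement6 (N : ℕ) (hN : 0 < N) (P : KatsuraPair (Fin N)) :
    Contracting P ↔
      limsup (fun n : ℕ => (maxRatioInf P n) ^ ((n : ℝ)⁻¹)) atTop < 1 := by
  exact contracting_iff_limsup_lt_one P
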